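/- Let m ≥ 4, let B be an adjacency basis of the path P_m = (w_1, w_2, …, w_m), and suppose R_1 and R_2 are gaps of B with w_1 ∈ R_1 and w_m ∈ R_2. Then: (1) every gap of B contains at most three vertices, and |R_i| ≤ 2 for i = 1, 2; (2) at most one gap of B contains three vertices, and at most one of the gaps R_1 and R_2 contains two vertices; (3) if |R_i| = 2 for some i ∈ {1,2}, then every gap of B contains at most two vertices; (4) if a gap of B contains at least two vertices, then every gap neighboring it is neither R_1 nor R_2 and contains exactly one vertex. -/

import Mathlib

open SimpleGraph

/-- `W` is an adjacency resolving set for `G`: distinct vertices have distinct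
vectors of truncated distances `min 2 (d(·,w))`, `w ∈ W`. -/
def IsAdjResolving {α : Type*} (G : SimpleGraph α) (W : Set α) : Prop :=
  ∀ u v : α, (∀ w ∈ W, min 2 (G.dist u w) = min 2 (G.dist v w)) → u = v

/-- The adjacency dimension of `G`. -/
noncomputable def adjDim {α : Type*} [Fintype α] (G : SimpleGraph α) : ℕ :=
  sInf {k | ∃ W : Finset α, W.card = k ∧ IsAdjResolving G ↑W}

/-- `B` is an adjacency basis of `G`: an adjacency resolving set of minimum
cardinality. -/
def IsAdjBasis {α : Type*} [Fintype α] (G : SimpleGraph α) (B : Finset α) : Prop :=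
  IsAdjResolving G ↑B ∧ B.card = adjDim G

/-- `Q` is a gap of the vertex set `S` in `G`: the vertex set of a (nonempty)
connected component of the subgraph induced on the complement of `S`. -/
def IsGap {α : Type*} (G : SimpleGraph α) (S : Set α) (Q : Set α) : Prop :=
  ∃ c : (G.induce Sᶜ).ConnectedComponent, Q = Subtype.val '' c.supp

/-- Two gaps `Q₁ ≠ Q₂` of `S` are neighboring if some `x ∈ S` makes the subgraph
induced on `Q₁ ∪ Q₂ ∪ {x}` connected. -/
def NeighboringGaps {α : Type*} (G : SimpleGraph α) (S : Set α) (Q₁ Q₂ : Set α) : Prop :=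
  Q₁ ≠ Q₂ ∧ ∃ x ∈ S, (G.induce (Q₁ ∪ Q₂ ∪ {x})).Connected

/-- In an induced subgraph of a path, a vertex lying between the ends of a walk is on the same
component. -/
theorem exists_reachable_of_walk_induce_pathGraph {m : ℕ} {T : Set (Fin m)} {u v : T}
    (p : ((pathGraph m).induce T).Walk u v) (w : Fin m)
    (hw : (u.1 ≤ w ∧ w ≤ v.1) ∨ (v.1 ≤ w ∧ w ≤ u.1)) :
    ∃ h : w ∈ T, ((pathGraph m).induce T).Reachable u ⟨w, h⟩ := by
  induction p with
  | nil =>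
    rename_i u
    obtain rfl : w = u.1 := by omega
    exact ⟨u.2, Reachable.refl _⟩
  | cons h p ih =>
    rename_i u u' v
    by_cases hwu : w = u.1
    · subst hwu
      exact ⟨u.2, Reachable.refl _⟩
    · have hadj : (pathGraph m).Adj u.1 u'.1 := h
      rw [pathGraph_adj] at hadj
      obtain ⟨hT, hr⟩ := ih (by omega)
      exact ⟨hT, h.reachable.trans hr⟩

/-- A vertex set inducing a connected subgraph of a path is order-connected. -/
theorem mem_of_induce_pathGraph_connected {m : ℕ} {T : Set (Fin m)}
    (hT : ((pathGraph m).induce T).Connected) {u v w : Fin m} (hu : u ∈ T) (hv : v ∈ T)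
    (huw : u ≤ w) (hwv : w ≤ v) : w ∈ T := by
  obtain ⟨p⟩ := hT.preconnected ⟨u, hu⟩ ⟨v, hv⟩
  exact (exists_reachable_of_walk_induce_pathGraph p w (Or.inl ⟨huw, hwv⟩)).1

/-- A gap of `S` in a path is a maximal interval avoiding `S`. -/
theorem IsGap.exists_eq_Icc {m : ℕ} {S Q : Set (Fin m)} (hQ : IsGap (pathGraph m) S Q) :
    ∃ a b : Fin m, a ≤ b ∧ Q = Set.Icc a b ∧ (∀ x ∈ S, x < a ∨ b < x) ∧
      (∀ x : Fin m, x.val + 1 = a.val → x ∈ S) ∧ (∀ x : Fin m, x.val = b.val + 1 → x ∈ S) := by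
  obtain ⟨c, rfl⟩ := hQ
  set Q : Set (Fin m) := Subtype.val '' c.supp with hQdef
  have hne : Q.Nonempty := c.nonempty_supp.image _
  have hS : ∀ x ∈ Q, x ∉ S := by
    rintro _ ⟨y, -, rfl⟩
    exact y.2
  have hconv : ∀ u ∈ Q, ∀ v ∈ Q, ∀ w, u ≤ w → w ≤ v → w ∈ Q := by
    rintro _ ⟨u, hu, rfl⟩ _ ⟨v, hv, rfl⟩ w huw hwv
    obtain ⟨p⟩ := ConnectedComponent.exact (hu.trans hv.symm)
    obtain ⟨h, hr⟩ := exists_reachable_of_walk_induce_pathGraph p w (Or.inl ⟨huw, hwv⟩)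
    exact ⟨⟨w, h⟩, (ConnectedComponent.sound hr.symm).trans hu, rfl⟩
  have hclosed : ∀ u ∈ Q, ∀ v, (pathGraph m).Adj u v → v ∉ Q → v ∈ S := by
    rintro _ ⟨u, hu, rfl⟩ v huv hv
    by_contra hvS
    have h : ((pathGraph m).induce Sᶜ).Adj ⟨v, hvS⟩ u := huv.symm
    exact hv ⟨⟨v, hvS⟩, (ConnectedComponent.sound h.reachable).trans hu, rfl⟩
  obtain ⟨a, ha, hmin⟩ := Set.exists_min_image Q id Q.toFinite hne
  obtain ⟨b, hb, hmax⟩ := Set.exists_max_image Q id Q.toFinite hne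
  simp only [id] at hmin hmax
  refine ⟨a, b, hmin b hb, ?_, ?_, ?_, ?_⟩
  · ext x
    exact ⟨fun hx => ⟨hmin x hx, hmax x hx⟩, fun hx => hconv a ha b hb x hx.1 hx.2⟩
  · intro x hx
    by_contra! h
    exact hS x (hconv a ha b hb x h.1 h.2) hx
  · intro x hx
    refine hclosed a ha x (pathGraph_adj.2 (Or.inr hx)) fun hxQ => ?_
    have := hmin x hxQ
    omega
  · intro x hx
    refine hclosed b hb x (pathGraph_adj.2 (Or.inl hx.symm)) fun hxQ => ?_
    have := hmax x hxQ
    omega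

/-- The interval describing a gap in a path, with natural number endpoints. -/
theorem IsGap.exists_bounds {m : ℕ} {S Q : Set (Fin m)} (hQ : IsGap (pathGraph m) S Q) :
    ∃ a b : ℕ, a ≤ b ∧ b < m ∧ (∀ x : Fin m, x ∈ Q ↔ a ≤ x.val ∧ x.val ≤ b) ∧
      Q.ncard = b + 1 - a ∧ (∀ x ∈ S, x.val < a ∨ b < x.val) ∧
      (∀ x : Fin m, x.val + 1 = a → x ∈ S) ∧ (∀ x : Fin m, x.val = b + 1 → x ∈ S) := by
  obtain ⟨a, b, hab, rfl, h₁, h₂, h₃⟩ := hQ.exists_eq_Icc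
  refine ⟨a, b, hab, b.2, fun x => Iff.rfl, ?_, h₁, h₂, h₃⟩
  rw [← Finset.coe_Icc, Set.ncard_coe_finset, Fin.card_Icc]

/-- Vertices outside an adjacency resolving set of a connected graph are determined by their
neighbors in the set. -/
theorem IsAdjResolving.eq_of_adj_iff {α : Type*} {G : SimpleGraph α} {W : Set α}
    (hW : IsAdjResolving G W) (hG : G.Preconnected) {u v : α} (hu : u ∉ W) (hv : v ∉ W)
    (h : ∀ w ∈ W, G.Adj u w ↔ G.Adj v w) : u = v := by
  have two_le : ∀ x w, x ∉ W → w ∈ W → ¬ G.Adj x w → 2 ≤ G.dist x w := by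
    intro x w hx hw hxw
    have h₀ : 0 < G.dist x w := (hG x w).pos_dist_of_ne (by rintro rfl; exact hx hw)
    have h₁ : G.dist x w ≠ 1 := fun h => hxw (dist_eq_one_iff_adj.1 h)
    omega
  refine hW u v fun w hw => ?_
  by_cases huw : G.Adj u w
  · rw [dist_eq_one_iff_adj.2 huw, dist_eq_one_iff_adj.2 ((h w hw).1 huw)]
  · rw [min_eq_left (two_le u w hu hw huw),
      min_eq_left (two_le v w hv hw fun hvw => huw ((h w hw).2 hvw))]

/-- The version of `IsAdjResolving.eq_of_adj_iff` for paths, in terms of vertex numbers. -/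
theorem IsAdjResolving.eq_of_pathGraph {m : ℕ} {W : Set (Fin m)}
    (hW : IsAdjResolving (pathGraph m) W) {u v : ℕ} (hu : u < m) (hv : v < m)
    (h : ∀ w ∈ W, w.val ≠ u ∧ w.val ≠ v ∧
      (u + 1 = w.val ∨ w.val + 1 = u ↔ v + 1 = w.val ∨ w.val + 1 = v)) : u = v := by
  have key := hW.eq_of_adj_iff (pathGraph_preconnected m) (u := ⟨u, hu⟩) (v := ⟨v, hv⟩)
    (fun hx => (h _ hx).1 rfl) (fun hx => (h _ hx).2.1 rfl)
    (fun w hw => by simpa only [pathGraph_adj] using (h w hw).2.2)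
  exact congrArg Fin.val key

/-- Distinct gaps of a path neighboring through `x` end, respectively start, next to `x`. -/
theorem NeighboringGaps.exists_between {m : ℕ} {S Q₁ Q₂ : Set (Fin m)} {a b c d : ℕ}
    (hN : NeighboringGaps (pathGraph m) S Q₁ Q₂) (hab : a ≤ b) (hbm : b < m) (hcd : c ≤ d)
    (hdm : d < m) (hQ₁ : ∀ x : Fin m, x ∈ Q₁ ↔ a ≤ x.val ∧ x.val ≤ b)
    (hQ₂ : ∀ x : Fin m, x ∈ Q₂ ↔ c ≤ x.val ∧ x.val ≤ d)
    (hS₁ : ∀ x ∈ S, x.val < a ∨ b < x.val) (hS₂ : ∀ x ∈ S, x.val < c ∨ d < x.val)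
    (ha : ∀ x : Fin m, x.val + 1 = a → x ∈ S) (hb : ∀ x : Fin m, x.val = b + 1 → x ∈ S)
    (hc : ∀ x : Fin m, x.val + 1 = c → x ∈ S) (hd : ∀ x : Fin m, x.val = d + 1 → x ∈ S) :
    b + 2 = c ∨ d + 2 = a := by
  obtain ⟨hne, x, hx, hconn⟩ := hN
  have hmem : ∀ y : Fin m, y ∈ Q₁ ∪ Q₂ ∪ {x} ↔
      ((a ≤ y.val ∧ y.val ≤ b) ∨ (c ≤ y.val ∧ y.val ≤ d)) ∨ y.val = x.val := by
    intro y
    rw [Set.mem_union, Set.mem_union, hQ₁, hQ₂, Set.mem_singleton_iff, Fin.ext_iff]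
  have hmid : ∀ i j k : ℕ, ∀ hi : i < m, ∀ hk : k < m, ∀ hj : j < m, i ≤ j → j ≤ k →
      (⟨i, hi⟩ : Fin m) ∈ Q₁ ∪ Q₂ ∪ {x} → (⟨k, hk⟩ : Fin m) ∈ Q₁ ∪ Q₂ ∪ {x} →
      ((a ≤ j ∧ j ≤ b) ∨ (c ≤ j ∧ j ≤ d)) ∨ j = x.val := by
    intro i j k hi hk hj hij hjk h₁ h₂
    exact (hmem ⟨j, hj⟩).1 (mem_of_induce_pathGraph_connected hconn h₁ h₂ hij hjk)
  have hsep : b < c ∨ d < a := by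
    by_contra! hcon
    apply hne
    have hac : a = c := by
      rcases lt_trichotomy a c with h | h | h
      · have := hS₁ _ (hc ⟨c - 1, by omega⟩ (by simp only; omega))
        simp only at this
        omega
      · exact h
      · have := hS₂ _ (ha ⟨a - 1, by omega⟩ (by simp only; omega))
        simp only at this
        omega
    have hbd : b = d := by
      rcases lt_trichotomy b d with h | h | h
      · have := hS₂ _ (hb ⟨b + 1, by omega⟩ rfl)
        simp only at this
        omega
      · exact h
      · have := hS₁ _ (hd ⟨d + 1, by omega⟩ rfl)
        simp only at this
        omega
    ext y
    rw [hQ₁, hQ₂, hac, hbd]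
  rcases hsep with h | h
  · left
    have hbS := hS₂ _ (hb ⟨b + 1, by omega⟩ rfl)
    have hcS := hS₁ _ (hc ⟨c - 1, by omega⟩ (by simp only; omega))
    simp only at hbS hcS
    have hbx := hmid b (b + 1) c hbm (by omega) (by omega) (by omega) (by omega)
      ((hmem _).2 (by simp only; omega)) ((hmem _).2 (by simp only; omega))
    have hcx := hmid b (c - 1) c hbm (by omega) (by omega) (by omega) (by omega)
      ((hmem _).2 (by simp only; omega)) ((hmem _).2 (by simp only; omega))
    omega
  · right
    have hdS := hS₁ _ (hd ⟨d + 1, by omega⟩ rfl)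
    have haS := hS₂ _ (ha ⟨a - 1, by omega⟩ (by simp only; omega))
    simp only at hdS haS
    have hdx := hmid d (d + 1) a hdm (by omega) (by omega) (by omega) (by omega)
      ((hmem _).2 (by simp only; omega)) ((hmem _).2 (by simp only; omega))
    have hax := hmid d (a - 1) a hdm (by omega) (by omega) (by omega) (by omega)
      ((hmem _).2 (by simp only; omega)) ((hmem _).2 (by simp only; omega))
    omega

/-- Observation on the gaps of an adjacency basis of the path `P_m`. -/
theorem gaps_of_adjBasis_pathGraph (m : ℕ) (hm : 4 ≤ m) (B : Finset (Fin m))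
    (hB : IsAdjBasis (pathGraph m) B) (R₁ R₂ : Set (Fin m))
    (hR₁ : IsGap (pathGraph m) ↑B R₁) (hR₂ : IsGap (pathGraph m) ↑B R₂)
    (hw₁ : (⟨0, by omega⟩ : Fin m) ∈ R₁) (hwm : (⟨m - 1, by omega⟩ : Fin m) ∈ R₂) :
    ((∀ Q : Set (Fin m), IsGap (pathGraph m) ↑B Q → Q.ncard ≤ 3) ∧
      R₁.ncard ≤ 2 ∧ R₂.ncard ≤ 2) ∧
    ((∀ Q₁ Q₂ : Set (Fin m), IsGap (pathGraph m) ↑B Q₁ → IsGap (pathGraph m) ↑B Q₂ →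
        Q₁.ncard = 3 → Q₂.ncard = 3 → Q₁ = Q₂) ∧
      ¬(R₁.ncard = 2 ∧ R₂.ncard = 2)) ∧
    ((R₁.ncard = 2 ∨ R₂.ncard = 2) →
      ∀ Q : Set (Fin m), IsGap (pathGraph m) ↑B Q → Q.ncard ≤ 2) ∧
    (∀ Q₁ Q₂ : Set (Fin m), IsGap (pathGraph m) ↑B Q₁ → IsGap (pathGraph m) ↑B Q₂ →
      2 ≤ Q₁.ncard → NeighboringGaps (pathGraph m) ↑B Q₁ Q₂ →
      Q₂ ≠ R₁ ∧ Q₂ ≠ R₂ ∧ Q₂.ncard = 1) := by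
  have hres := hB.1
  have hle : ∀ Q : Set (Fin m), IsGap (pathGraph m) ↑B Q → Q.ncard ≤ 3 := by
    intro Q hQ
    obtain ⟨a, b, hab, hbm, -, hcard, hS, -, -⟩ := hQ.exists_bounds
    by_contra! hlt
    have := hres.eq_of_pathGraph (u := a + 1) (v := a + 2) (by omega) (by omega)
      (fun w hw => by have := hS w hw; omega)
    omega
  obtain ⟨a₁, b₁, hab₁, hbm₁, hQ₁, hcard₁, hS₁, -, -⟩ := hR₁.exists_bounds
  obtain ⟨a₂, b₂, hab₂, hbm₂, hQ₂, hcard₂, hS₂, -, -⟩ := hR₂.exists_bounds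
  have ha₁ := (hQ₁ _).1 hw₁
  have hb₂ := (hQ₂ _).1 hwm
  simp only at ha₁ hb₂
  have hle₁ : R₁.ncard ≤ 2 := by
    by_contra! hlt
    have := hres.eq_of_pathGraph (u := 0) (v := 1) (by omega) (by omega)
      (fun w hw => by have := hS₁ w hw; omega)
    omega
  have hle₂ : R₂.ncard ≤ 2 := by
    by_contra! hlt
    have := hres.eq_of_pathGraph (u := m - 1) (v := m - 2) (by omega) (by omega)
      (fun w hw => by have := hS₂ w hw; omega)
    omega
  refine ⟨⟨hle, hle₁, hle₂⟩, ⟨?_, ?_⟩, ?_, ?_⟩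
  · intro P Q hP hQ hPcard hQcard
    obtain ⟨a, b, hab, hbm, hPmem, hPc, hPS, -, -⟩ := hP.exists_bounds
    obtain ⟨c, d, hcd, hdm, hQmem, hQc, hQS, -, -⟩ := hQ.exists_bounds
    have := hres.eq_of_pathGraph (u := a + 1) (v := c + 1) (by omega) (by omega)
      (fun w hw => by have := hPS w hw; have := hQS w hw; omega)
    ext y
    rw [hPmem, hQmem]
    omega
  · rintro ⟨h₁, h₂⟩
    have := hres.eq_of_pathGraph (u := 0) (v := m - 1) (by omega) (by omega)
      (fun w hw => by have := hS₁ w hw; have := hS₂ w hw; omega)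
    omega
  · intro h Q hQ
    obtain ⟨a, b, hab, hbm, -, hQc, hQS, -, -⟩ := hQ.exists_bounds
    have hQ3 := hle Q hQ
    by_contra! hlt
    rcases h with h | h
    · have := hres.eq_of_pathGraph (u := 0) (v := a + 1) (by omega) (by omega)
        (fun w hw => by have := hS₁ w hw; have := hQS w hw; omega)
      omega
    · have := hres.eq_of_pathGraph (u := m - 1) (v := a + 1) (by omega) (by omega)
        (fun w hw => by have := hS₂ w hw; have := hQS w hw; omega)
      omega
  · intro P Q hP hQ hPcard hN
    obtain ⟨a, b, hab, hbm, hPmem, hPc, hPS, ha, hb⟩ := hP.exists_bounds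
    obtain ⟨c, d, hcd, hdm, hQmem, hQc, hQS, hc, hd⟩ := hQ.exists_bounds
    have hbetween := hN.exists_between hab hbm hcd hdm hPmem hQmem hPS hQS ha hb hc hd
    have hinner : 0 < c ∧ d + 1 < m ∧ c = d := by
      by_contra hcon
      rcases hbetween with h | h
      · have := hres.eq_of_pathGraph (u := b) (v := c) (by omega) (by omega)
          (fun w hw => by have := hPS w hw; have := hQS w hw; omega)
        omega
      · have := hres.eq_of_pathGraph (u := a) (v := d) (by omega) (by omega)
          (fun w hw => by have := hPS w hw; have := hQS w hw; omega)
        omega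
    refine ⟨?_, ?_, by omega⟩
    · rintro rfl
      have := (hQmem _).1 hw₁
      simp only at this
      omega
    · rintro rfl
      have := (hQmem _).1 hwm
      simp only at this
      omega
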